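/- arXiv:1503.02395 — 2 statements merged into one kernel-verified Lean document; each statement's English description precedes it below -/
import Mathlib

section
/- Let ε, C₁ ≥ 0 and let Φ : [0,∞) → ℝ be continuous on [0,∞) and twice continuously differentiable on (0,∞), satisfying |Φ''(s) − Φ'(s)/s| ≤ 4εs⁴ + 4C₁s² for all s > 0. Then there exist constants C₂, C₃ ≥ 0 such that |Φ(s)| ≤ (ε/6)s⁶ + (C₁/2)s⁴ + C₂s² + C₃ for all s ≥ 0. -/
open Set

/-- If `|f'| ≤ B'` on `[a, ∞)` and `|f a| ≤ B a`, then `|f| ≤ B` on `[a, ∞)`. -/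
theorem abs_le_of_hasDerivAt_of_abs_le {f f' B B' : ℝ → ℝ} {a : ℝ}
    (hf : ∀ x, a ≤ x → HasDerivAt f (f' x) x) (hB : ∀ x, HasDerivAt B (B' x) x)
    (ha : |f a| ≤ B a) (bound : ∀ x, a ≤ x → |f' x| ≤ B' x) {x : ℝ} (hx : a ≤ x) :
    |f x| ≤ B x :=
  image_norm_le_of_norm_deriv_right_le_deriv_boundary (b := x)
    (fun y hy => (hf y hy.1).continuousAt.continuousWithinAt)
    (fun y hy => (hf y hy.1).hasDerivWithinAt) ha hB
    (fun y hy => bound y hy.1) (right_mem_Icc.2 hx)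

/-- Lemma 3.1 estimate: if `Φ` is continuous on `[0,∞)`, `C²` on `(0,∞)`, and
`|Φ''(s) − Φ'(s)/s| ≤ 4εs⁴ + 4C₁s²` for `s > 0`, then there are constants `C₂, C₃ ≥ 0`
with `|Φ(s)| ≤ (ε/6)s⁶ + (C₁/2)s⁴ + C₂s² + C₃` for all `s ≥ 0`. -/
theorem stmt1 (ε C₁ : ℝ) (hε : 0 ≤ ε) (hC₁ : 0 ≤ C₁) (Φ : ℝ → ℝ)
    (hΦc : ContinuousOn Φ (Ici 0))
    (hΦd : ContDiffOn ℝ 2 Φ (Ioi 0))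
    (hΦ'' : ∀ s, 0 < s →
      |deriv (deriv Φ) s - deriv Φ s / s| ≤ 4 * ε * s ^ 4 + 4 * C₁ * s ^ 2) :
    ∃ C₂ C₃ : ℝ, 0 ≤ C₂ ∧ 0 ≤ C₃ ∧ ∀ s, 0 ≤ s →
      |Φ s| ≤ ε / 6 * s ^ 6 + C₁ / 2 * s ^ 4 + C₂ * s ^ 2 + C₃ := by
  have hd : ∀ s, 0 < s → HasDerivAt Φ (deriv Φ s) s := fun s hs =>
    ((hΦd.differentiableOn (by norm_num)).differentiableAt (Ioi_mem_nhds hs)).hasDerivAt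
  have hd' : ∀ s, 0 < s → HasDerivAt (deriv Φ) (deriv (deriv Φ) s) s := fun s hs =>
    (((hΦd.deriv_of_isOpen (m := 1) isOpen_Ioi (by norm_num)).differentiableOn
      (by norm_num)).differentiableAt (Ioi_mem_nhds hs)).hasDerivAt
  set A := |deriv Φ 1| with hA
  have hA0 : 0 ≤ A := abs_nonneg _
  have hslope : ∀ s, 1 ≤ s → |deriv Φ s / s| ≤ ε * s ^ 4 + 2 * C₁ * s ^ 2 + A := by
    intro s hs
    refine abs_le_of_hasDerivAt_of_abs_le (a := 1) (f := fun s => deriv Φ s / s)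
      (f' := fun s => (deriv (deriv Φ) s - deriv Φ s / s) / s)
      (B := fun s => ε * s ^ 4 + 2 * C₁ * s ^ 2 + A)
      (B' := fun s => 4 * ε * s ^ 3 + 4 * C₁ * s) ?_ ?_ ?_ ?_ hs
    · intro x hx
      have hx0 : 0 < x := by linarith
      refine ((hd' x hx0).div (hasDerivAt_id x) hx0.ne').congr_deriv ?_
      simp only [id]
      field_simp
    · intro x
      refine (((((hasDerivAt_id x).pow 4).const_mul ε).add
        (((hasDerivAt_id x).pow 2).const_mul (2 * C₁))).add_const A).congr_deriv ?_
      simp only [id]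
      push_cast
      ring
    · simp only [div_one, one_pow, mul_one]
      linarith
    · intro x hx
      have hx0 : 0 < x := by linarith
      rw [abs_div, abs_of_pos hx0, div_le_iff₀ hx0]
      linarith [hΦ'' x hx0]
  obtain ⟨M, hM⟩ := isCompact_Icc.exists_bound_of_continuousOn
    (hΦc.mono (Icc_subset_Ici_self : Icc (0 : ℝ) 1 ⊆ Ici 0))
  have hM1 : |Φ 1| ≤ M := hM 1 (by norm_num)
  have hM0 : 0 ≤ M := (abs_nonneg _).trans hM1
  refine ⟨A / 2, M, by positivity, hM0, fun s hs => ?_⟩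
  rcases le_total s 1 with hs1 | hs1
  · have h := hM s ⟨hs, hs1⟩
    rw [Real.norm_eq_abs] at h
    have : 0 ≤ ε / 6 * s ^ 6 + C₁ / 2 * s ^ 4 + A / 2 * s ^ 2 := by positivity
    linarith
  · refine abs_le_of_hasDerivAt_of_abs_le (a := 1) (f := Φ) (f' := deriv Φ)
      (B := fun s => ε / 6 * s ^ 6 + C₁ / 2 * s ^ 4 + A / 2 * s ^ 2 + M)
      (B' := fun s => ε * s ^ 5 + 2 * C₁ * s ^ 3 + A * s)
      (fun x hx => hd x (by linarith)) ?_ ?_ ?_ hs1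
    · intro x
      refine ((((((hasDerivAt_id x).pow 6).const_mul (ε / 6)).add
        (((hasDerivAt_id x).pow 4).const_mul (C₁ / 2))).add
        (((hasDerivAt_id x).pow 2).const_mul (A / 2))).add_const M).congr_deriv ?_
      simp only [id]
      push_cast
      ring
    · simp only [one_pow, mul_one]
      linarith
    · intro x hx
      have hx0 : 0 < x := by linarith
      have h := hslope x hx
      rw [abs_div, abs_of_pos hx0, div_le_iff₀ hx0] at h
      linarith
end

section
/- For every compact interval I ⊂ ℝ and every M > 0 there exists a constant C_M ≥ 0 such that for all r ∈ I and all u, ũ ∈ E × E with ‖u‖ ≤ M and ‖ũ‖ ≤ M, one has ‖J(r,ũ) − J(r,u)‖ ≤ C_M·‖ũ − u‖. That is, J is locally Lipschitz in its second argument, uniformly in r on compact intervals. -/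
open Set

theorem ContinuousLinearMap.norm_apply_apply_self_sub_le {𝕜 V W : Type*}
    [NontriviallyNormedField 𝕜] [SeminormedAddCommGroup V] [NormedSpace 𝕜 V]
    [SeminormedAddCommGroup W] [NormedSpace 𝕜 W] (A B : V →L[𝕜] V →L[𝕜] W) (x y : V) :
    ‖A x x - B y y‖ ≤ ‖A - B‖ * ‖x‖ * ‖x‖ + ‖B‖ * ‖x - y‖ * (‖x‖ + ‖y‖) := by
  have h : A x x - B y y = (A - B) x x + (B (x - y) x + B y (x - y)) := by
    simp
  calc ‖A x x - B y y‖ ≤ ‖(A - B) x x‖ + (‖B (x - y) x‖ + ‖B y (x - y)‖) := by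
        rw [h]
        exact (norm_add_le _ _).trans (by gcongr; exact norm_add_le _ _)
    _ ≤ ‖A - B‖ * ‖x‖ * ‖x‖ + (‖B‖ * ‖x - y‖ * ‖x‖ + ‖B‖ * ‖y‖ * ‖x - y‖) := by
        gcongr <;> exact ContinuousLinearMap.le_opNorm₂ _ _ _
    _ = _ := by ring

theorem Continuous.exists_nonneg_abs_le_on_Icc {f : ℝ → ℝ} (hf : Continuous f) (a b : ℝ) :
    ∃ K, 0 ≤ K ∧ ∀ r ∈ Icc a b, |f r| ≤ K := by
  obtain ⟨K, hK⟩ := isCompact_Icc.exists_bound_of_continuousOn (hf.continuousOn (s := Icc a b))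
  exact ⟨max K 0, le_max_right _ _, fun r hr => (hK r hr).trans (le_max_left _ _)⟩

/-- Lemma 4.2: the supergravity operator `J` is locally Lipschitz in its second argument,
uniformly in `r` on compact intervals. -/
theorem stmt3 {n : ℕ} (hn : 1 ≤ n) (ε C₁ C₄ C₅ : ℝ) (hε : 0 ≤ ε) (hC₁ : 0 ≤ C₁)
    (hC₄ : 0 ≤ C₄) (hC₅ : 0 ≤ C₅)
    (F G H : ℝ → ℝ) (hF : Continuous F) (hG : Continuous G) (hH : Continuous H)
    (Γ : EuclideanSpace ℂ (Fin n) →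
      (EuclideanSpace ℂ (Fin n) →L[ℂ] EuclideanSpace ℂ (Fin n) →L[ℂ] EuclideanSpace ℂ (Fin n)))
    (hΓ : ∀ φ, ‖Γ φ‖ ≤ 2 * ε * ‖φ‖ ^ 3 + C₁ * ‖φ‖)
    (hΓ' : ∀ φ φ', ‖Γ φ' - Γ φ‖ ≤
      (2 * ε * (‖φ'‖ ^ 2 + ‖φ'‖ * ‖φ‖ + ‖φ‖ ^ 2) + C₁) * ‖φ' - φ‖)
    (W₁ W₂ : EuclideanSpace ℂ (Fin n) → EuclideanSpace ℂ (Fin n))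
    (hW₁ : ∀ φ φ', ‖W₁ φ' - W₁ φ‖ ≤ C₄ * ‖φ' - φ‖)
    (hW₂ : ∀ φ φ', ‖W₂ φ' - W₂ φ‖ ≤ C₅ * ‖φ' - φ‖)
    (J : ℝ → EuclideanSpace ℂ (Fin n) × EuclideanSpace ℂ (Fin n) →
      EuclideanSpace ℂ (Fin n) × EuclideanSpace ℂ (Fin n))
    (hJ : ∀ r φ π, J r (φ, π) =
      (π, (-F r) • π - Γ φ π π + G r • W₁ φ + H r • W₂ φ)) :
    ∀ a b M : ℝ, 0 < M → ∃ C_M : ℝ, 0 ≤ C_M ∧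
      ∀ r ∈ Icc a b, ∀ u u' : EuclideanSpace ℂ (Fin n) × EuclideanSpace ℂ (Fin n),
        ‖u‖ ≤ M → ‖u'‖ ≤ M → ‖J r u' - J r u‖ ≤ C_M * ‖u' - u‖ := by
  intro a b M hM
  obtain ⟨KF, hKF, hFb⟩ := hF.exists_nonneg_abs_le_on_Icc a b
  obtain ⟨KG, hKG, hGb⟩ := hG.exists_nonneg_abs_le_on_Icc a b
  obtain ⟨KH, hKH, hHb⟩ := hH.exists_nonneg_abs_le_on_Icc a b
  have hS : 0 ≤ KF + ((2 * ε * (M ^ 2 + M * M + M ^ 2) + C₁) * M * M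
      + (2 * ε * M ^ 3 + C₁ * M) * (M + M)) + KG * C₄ + KH * C₅ := by positivity
  refine ⟨1 + _, add_nonneg zero_le_one hS, ?_⟩
  rintro r hr ⟨φ, π⟩ ⟨φ', π'⟩ hu hu'
  obtain ⟨hφ, hπ⟩ : ‖φ‖ ≤ M ∧ ‖π‖ ≤ M := norm_prod_le_iff.mp hu
  obtain ⟨hφ', hπ'⟩ : ‖φ'‖ ≤ M ∧ ‖π'‖ ≤ M := norm_prod_le_iff.mp hu'
  have hdφ : ‖φ' - φ‖ ≤ ‖(φ', π') - (φ, π)‖ := norm_fst_le ((φ', π') - (φ, π))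
  have hdπ : ‖π' - π‖ ≤ ‖(φ', π') - (φ, π)‖ := norm_snd_le ((φ', π') - (φ, π))
  set D := ‖(φ', π') - (φ, π)‖
  have hD : 0 ≤ D := norm_nonneg _
  have hF' : ‖(-F r) • (π' - π)‖ ≤ KF * D := by
    rw [norm_smul, norm_neg, Real.norm_eq_abs]
    gcongr
    exact hFb r hr
  have hB : ‖Γ φ' π' π' - Γ φ π π‖ ≤ (2 * ε * (M ^ 2 + M * M + M ^ 2) + C₁) * D * M * M
      + (2 * ε * M ^ 3 + C₁ * M) * D * (M + M) := by
    have h₁ : ‖Γ φ' - Γ φ‖ ≤ (2 * ε * (M ^ 2 + M * M + M ^ 2) + C₁) * D :=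
      (hΓ' φ φ').trans (by gcongr)
    have h₂ : ‖Γ φ‖ ≤ 2 * ε * M ^ 3 + C₁ * M := (hΓ φ).trans (by gcongr)
    exact (ContinuousLinearMap.norm_apply_apply_self_sub_le _ _ _ _).trans (by gcongr)
  have hG' : ‖G r • (W₁ φ' - W₁ φ)‖ ≤ KG * (C₄ * D) := by
    rw [norm_smul, Real.norm_eq_abs]
    gcongr
    · exact hGb r hr
    · exact (hW₁ φ φ').trans (by gcongr)
  have hH' : ‖H r • (W₂ φ' - W₂ φ)‖ ≤ KH * (C₅ * D) := by
    rw [norm_smul, Real.norm_eq_abs]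
    gcongr
    · exact hHb r hr
    · exact (hW₂ φ φ').trans (by gcongr)
  rw [hJ, hJ, Prod.mk_sub_mk, norm_prod_le_iff]
  constructor
  · nlinarith [mul_nonneg hS hD]
  · have hsplit : (-F r) • π' - Γ φ' π' π' + G r • W₁ φ' + H r • W₂ φ'
        - ((-F r) • π - Γ φ π π + G r • W₁ φ + H r • W₂ φ)
        = (-F r) • (π' - π) - (Γ φ' π' π' - Γ φ π π) + G r • (W₁ φ' - W₁ φ)
          + H r • (W₂ φ' - W₂ φ) := by
      simp only [smul_sub]
      abel
    rw [hsplit]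
    refine (norm_add₃_le.trans (add_le_add_left (add_le_add_left (norm_sub_le _ _) _) _)).trans ?_
    linarith
end
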